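/- arXiv:1702.04126 — 6 statements merged into one kernel-verified Lean document; each statement's English description precedes it below -/
import Mathlib

section
/- Let X and Y be real-valued random variables with finite expectation. Then X second-order stochastically dominates Y if and only if for every a ∈ ℝ, ∫_{-∞}^{a} (P(Y ≤ s) − P(X ≤ s)) ds ≥ 0. -/
open MeasureTheory ProbabilityTheory
open scoped NNReal ENNReal

/-- Second-order stochastic dominance between two distributions on `ℝ`:
`μ ≽ₛₛ𝒹 ν` iff for every concave non-decreasing `u : ℝ → ℝ` for which both
expectations exist, the expectation of `u` under `μ` is at least that under `ν`. -/
def SSD (μ ν : Measure ℝ) : Prop :=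
  ∀ u : ℝ → ℝ, ConcaveOn ℝ Set.univ u → Monotone u →
    Integrable u μ → Integrable u ν →
    ∫ x, u x ∂ν ≤ ∫ x, u x ∂μ

open Set Filter Topology

/-- A monotone concave function on `ℝ` is an indefinite integral of a nonnegative antitone
function. -/
lemma ConcaveOn.exists_antitone_integral_eq_sub {u : ℝ → ℝ} (hu : ConcaveOn ℝ univ u)
    (hm : Monotone u) :
    ∃ g : ℝ → ℝ, Antitone g ∧ (∀ s, 0 ≤ g s) ∧ ∀ a b, ∫ s in a..b, g s = u b - u a := by
  have hf : ConvexOn ℝ univ (-u) := hu.neg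
  have hmono : Monotone fun x ↦ derivWithin (-u) (Ioi x) x := by
    have := hf.monotoneOn_rightDeriv
    rw [interior_univ] at this
    exact monotoneOn_univ.1 this
  have hcont : Continuous u := continuousOn_univ.1 (hu.continuousOn isOpen_univ)
  refine ⟨fun x ↦ -derivWithin (-u) (Ioi x) x, fun x y hxy ↦ neg_le_neg (hmono hxy),
    fun s ↦ ?_, fun a b ↦ ?_⟩
  · exact neg_nonneg.2 ((hm.neg.antitoneOn _).derivWithin_nonpos)
  · refine intervalIntegral.integral_eq_sub_of_hasDeriv_right hcont.continuousOn (fun x _ ↦ ?_)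
      hmono.intervalIntegrable.neg
    simpa using (hf.hasDerivWithinAt_rightDeriv_of_mem_interior (x := x) (by simp)).neg

/-- A nonempty lower set of reals that is bounded above meets `(x, ∞)` in a set of length
`(sSup S - x)⁺`. -/
lemma IsLowerSet.volume_inter_Ioi {S : Set ℝ} (hS : IsLowerSet S) (hne : S.Nonempty)
    (hb : BddAbove S) (x : ℝ) : volume (S ∩ Ioi x) = ENNReal.ofReal (sSup S - x) := by
  apply le_antisymm
  · rw [← Real.volume_Ioc]
    exact measure_mono fun s hs ↦ ⟨hs.2, le_csSup hb hs.1⟩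
  · rw [← Real.volume_Ioo]
    refine measure_mono fun s hs ↦ ⟨?_, hs.1⟩
    obtain ⟨y, hy, hsy⟩ := exists_lt_of_lt_csSup hne hs.2
    exact hS hsy.le hy

/-- The integral of the distribution function over `(-∞, a]` is the expectation of `(a - x)⁺`. -/
lemma setLIntegral_ofReal_cdf (μ : Measure ℝ) [IsProbabilityMeasure μ] (a : ℝ) :
    ∫⁻ s in Iic a, ENNReal.ofReal (cdf μ s) = ∫⁻ x, ENNReal.ofReal (a - x) ∂μ := by
  have hmeas : MeasurableSet {p : ℝ × ℝ | p.2 ≤ p.1} :=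
    measurableSet_le measurable_snd measurable_fst
  calc ∫⁻ s in Iic a, ENNReal.ofReal (cdf μ s)
      = ∫⁻ s in Iic a, ∫⁻ x, {p : ℝ × ℝ | p.2 ≤ p.1}.indicator 1 (s, x) ∂μ := by
        refine lintegral_congr fun s ↦ ?_
        rw [ofReal_cdf, ← lintegral_indicator_one measurableSet_Iic]
        rfl
    _ = ∫⁻ x, (∫⁻ s in Iic a, {p : ℝ × ℝ | p.2 ≤ p.1}.indicator 1 (s, x)) ∂μ :=
        lintegral_lintegral_swap (measurable_one.indicator hmeas).aemeasurable
    _ = ∫⁻ x, ENNReal.ofReal (a - x) ∂μ := by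
        refine lintegral_congr fun x ↦ ?_
        rw [← Real.volume_Icc, ← Ici_inter_Iic, ← Measure.restrict_apply measurableSet_Ici,
          ← lintegral_indicator_one measurableSet_Ici]
        rfl

lemma lintegral_ofReal_sub_ne_top {μ : Measure ℝ} [IsFiniteMeasure μ]
    (hμ : Integrable (fun x ↦ x) μ) (a : ℝ) : ∫⁻ x, ENNReal.ofReal (a - x) ∂μ ≠ ∞ :=
  ((integrable_const a).sub hμ).lintegral_lt_top.ne

lemma integrableOn_cdf_Iic {μ : Measure ℝ} [IsProbabilityMeasure μ]
    (hμ : Integrable (fun x ↦ x) μ) (a : ℝ) : IntegrableOn (cdf μ) (Iic a) := by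
  refine ⟨(monotone_cdf μ).measurable.aestronglyMeasurable, ?_⟩
  rw [hasFiniteIntegral_iff_ofReal (ae_of_all _ (cdf_nonneg μ)), setLIntegral_ofReal_cdf]
  exact (lintegral_ofReal_sub_ne_top hμ a).lt_top

lemma setIntegral_cdf_Iic (μ : Measure ℝ) [IsProbabilityMeasure μ] (a : ℝ) :
    ∫ s in Iic a, cdf μ s = (∫⁻ x, ENNReal.ofReal (a - x) ∂μ).toReal := by
  rw [integral_eq_lintegral_of_nonneg_ae (ae_of_all _ (cdf_nonneg μ))
    (monotone_cdf μ).measurable.aestronglyMeasurable, setLIntegral_ofReal_cdf]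

lemma integral_cdf_sub_nonneg_iff {μ ν : Measure ℝ} [IsProbabilityMeasure μ]
    [IsProbabilityMeasure ν] (hμ : Integrable (fun x ↦ x) μ) (hν : Integrable (fun x ↦ x) ν)
    (a : ℝ) : 0 ≤ ∫ s in Iic a, (cdf ν s - cdf μ s) ↔
      ∫⁻ x, ENNReal.ofReal (a - x) ∂μ ≤ ∫⁻ x, ENNReal.ofReal (a - x) ∂ν := by
  rw [integral_sub (integrableOn_cdf_Iic hν a) (integrableOn_cdf_Iic hμ a), setIntegral_cdf_Iic,
    setIntegral_cdf_Iic, sub_nonneg, ENNReal.toReal_le_toReal (lintegral_ofReal_sub_ne_top hμ a)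
    (lintegral_ofReal_sub_ne_top hν a)]

lemma SSD.lintegral_ofReal_sub_le {μ ν : Measure ℝ} [IsProbabilityMeasure μ]
    [IsProbabilityMeasure ν] (h : SSD μ ν) (hμ : Integrable (fun x ↦ x) μ)
    (hν : Integrable (fun x ↦ x) ν) (a : ℝ) :
    ∫⁻ x, ENNReal.ofReal (a - x) ∂μ ≤ ∫⁻ x, ENNReal.ofReal (a - x) ∂ν := by
  have hint : ∀ {ρ : Measure ℝ} [IsProbabilityMeasure ρ], Integrable (fun x ↦ x) ρ →
      Integrable (fun x ↦ max (a - x) 0) ρ := fun hρ ↦ ((integrable_const a).sub hρ).pos_part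
  have hconv : ConvexOn ℝ univ fun x : ℝ ↦ max (a - x) 0 :=
    ((convexOn_const a convex_univ).sub (concaveOn_id convex_univ)).sup
      (convexOn_const 0 convex_univ)
  have hle := h (fun x ↦ -max (a - x) 0) hconv.neg
    (fun x y hxy ↦ neg_le_neg (max_le_max (by linarith) le_rfl)) (hint hμ).neg (hint hν).neg
  rw [integral_neg, integral_neg, neg_le_neg_iff] at hle
  have key : ∀ {ρ : Measure ℝ} [IsProbabilityMeasure ρ], Integrable (fun x ↦ x) ρ →
      ∫⁻ x, ENNReal.ofReal (a - x) ∂ρ = ENNReal.ofReal (∫ x, max (a - x) 0 ∂ρ) := by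
    intro ρ _ hρ
    rw [ofReal_integral_eq_lintegral_ofReal (hint hρ) (ae_of_all _ fun x ↦ le_max_right _ _)]
    simp [ENNReal.ofReal_max]
  rw [key hμ, key hν]
  exact ENNReal.ofReal_le_ofReal hle

/-- If the expectations of the functions `(a - x)⁺` are ordered, then so are those of
`∫ s in (x, M), g s` for every nonnegative antitone `g`. -/
lemma lintegral_setLIntegral_antitone_le {μ ν : Measure ℝ} [SFinite μ] [SFinite ν]
    (h : ∀ a : ℝ, ∫⁻ x, ENNReal.ofReal (a - x) ∂μ ≤ ∫⁻ x, ENNReal.ofReal (a - x) ∂ν)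
    {g : ℝ → ℝ} (hg : Antitone g) (hg0 : ∀ s, 0 ≤ g s) (M : ℝ) :
    ∫⁻ x, (∫⁻ s in Ioo x M, ENNReal.ofReal (g s)) ∂μ ≤
      ∫⁻ x, (∫⁻ s in Ioo x M, ENNReal.ofReal (g s)) ∂ν := by
  have layer : ∀ x, ∫⁻ s in Ioo x M, ENNReal.ofReal (g s) =
      ∫⁻ t in Ioi (0 : ℝ), volume ({s | s < M ∧ t < g s} ∩ Ioi x) := by
    intro x
    rw [lintegral_eq_lintegral_meas_lt _ (ae_of_all _ hg0) hg.measurable.aemeasurable]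
    refine lintegral_congr fun t ↦ ?_
    rw [Measure.restrict_apply (measurableSet_lt measurable_const hg.measurable)]
    congr 1
    ext s
    simp only [mem_inter_iff, mem_ofPred_eq, mem_Ioo, mem_Ioi]
    tauto
  have hmeas : Measurable fun p : ℝ × ℝ ↦ volume ({s | s < M ∧ p.2 < g s} ∩ Ioi p.1) := by
    have hset : MeasurableSet {q : (ℝ × ℝ) × ℝ | (q.2 < M ∧ q.1.2 < g q.2) ∧ q.1.1 < q.2} :=
      ((measurableSet_lt measurable_snd measurable_const).inter
        (measurableSet_lt measurable_fst.snd (hg.measurable.comp measurable_snd))).inter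
        (measurableSet_lt measurable_fst.fst measurable_snd)
    exact measurable_measure_prodMk_left hset
  simp_rw [layer]
  rw [lintegral_lintegral_swap (μ := μ) hmeas.aemeasurable,
    lintegral_lintegral_swap (μ := ν) hmeas.aemeasurable]
  refine lintegral_mono fun t ↦ ?_
  rcases {s | s < M ∧ t < g s}.eq_empty_or_nonempty with hS | hS
  · simp [hS]
  · have hlow : IsLowerSet {s | s < M ∧ t < g s} :=
      fun x y hyx hx ↦ ⟨hyx.trans_lt hx.1, hx.2.trans_le (hg hyx)⟩
    simp_rw [hlow.volume_inter_Ioi hS ⟨M, fun s hs ↦ hs.1.le⟩]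
    exact h _

/-- The functions `x ↦ u (min x M)` with `u` concave and monotone have ordered expectations as
soon as the functions `(a - x)⁺` do. -/
lemma integral_comp_min_le {μ ν : Measure ℝ} [IsProbabilityMeasure μ] [IsProbabilityMeasure ν]
    (h : ∀ a : ℝ, ∫⁻ x, ENNReal.ofReal (a - x) ∂μ ≤ ∫⁻ x, ENNReal.ofReal (a - x) ∂ν)
    {u : ℝ → ℝ} (hu : ConcaveOn ℝ univ u) (hm : Monotone u) (M : ℝ)
    (hμ : Integrable (fun x ↦ u (min x M)) μ) (hν : Integrable (fun x ↦ u (min x M)) ν) :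
    ∫ x, u (min x M) ∂ν ≤ ∫ x, u (min x M) ∂μ := by
  obtain ⟨g, hg, hg0, hgu⟩ := hu.exists_antitone_integral_eq_sub hm
  have hv : ∀ x, ENNReal.ofReal (u M - u (min x M)) = ∫⁻ s in Ioo x M, ENNReal.ofReal (g s) := by
    intro x
    rcases le_total M x with hx | hx
    · simp [hx]
    · rw [min_eq_left hx, ← hgu, intervalIntegral.integral_of_le hx, restrict_Ioo_eq_restrict_Ioc,
        ofReal_integral_eq_lintegral_ofReal _ (ae_of_all _ hg0)]
      exact (intervalIntegrable_iff_integrableOn_Ioc_of_le hx).1 hg.intervalIntegrable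
  have hle := lintegral_setLIntegral_antitone_le h hg hg0 M
  simp_rw [← hv] at hle
  have hnn : ∀ x, 0 ≤ u M - u (min x M) := fun x ↦ sub_nonneg.2 (hm (min_le_right x M))
  have hμ' : Integrable (fun x ↦ u M - u (min x M)) μ := (integrable_const _).sub hμ
  have hν' : Integrable (fun x ↦ u M - u (min x M)) ν := (integrable_const _).sub hν
  rw [← ofReal_integral_eq_lintegral_ofReal hμ' (ae_of_all _ hnn),
    ← ofReal_integral_eq_lintegral_ofReal hν' (ae_of_all _ hnn),
    ENNReal.ofReal_le_ofReal_iff (integral_nonneg hnn),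
    integral_sub (integrable_const _) hμ, integral_sub (integrable_const _) hν] at hle
  simp only [integral_const, probReal_univ, one_smul] at hle
  linarith

lemma ssd_of_lintegral_ofReal_sub_le {μ ν : Measure ℝ} [IsProbabilityMeasure μ]
    [IsProbabilityMeasure ν]
    (h : ∀ a : ℝ, ∫⁻ x, ENNReal.ofReal (a - x) ∂μ ≤ ∫⁻ x, ENNReal.ofReal (a - x) ∂ν) :
    SSD μ ν := by
  intro u hu hm hμ hν
  have hmeas : ∀ M, Measurable fun x ↦ u (min x M) := fun M ↦
    hm.measurable.comp (measurable_id.min measurable_const)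
  have hbound : ∀ n : ℕ, ∀ x, ‖u (min x n)‖ ≤ |u x| + |u 0| := by
    intro n x
    rw [Real.norm_eq_abs]
    rcases le_total x n with hx | hx
    · rw [min_eq_left hx]
      linarith [abs_nonneg (u 0)]
    · rw [min_eq_right hx]
      have h1 := hm hx
      have h2 := hm (Nat.cast_nonneg (α := ℝ) n)
      refine abs_le.2 ⟨?_, ?_⟩
      · linarith [neg_abs_le (u 0), abs_nonneg (u x)]
      · linarith [le_abs_self (u x), abs_nonneg (u 0)]
  have hlim : ∀ x, Tendsto (fun n : ℕ ↦ u (min x n)) atTop (𝓝 (u x)) := by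
    intro x
    refine tendsto_const_nhds.congr' ?_
    filter_upwards [tendsto_natCast_atTop_atTop.eventually_ge_atTop x] with n hn
    rw [min_eq_left hn]
  have hdom : ∀ {ρ : Measure ℝ} [IsProbabilityMeasure ρ], Integrable u ρ →
      Integrable (fun x ↦ |u x| + |u 0|) ρ := fun hρ ↦ hρ.abs.add (integrable_const _)
  have hint : ∀ {ρ : Measure ℝ} [IsProbabilityMeasure ρ], Integrable u ρ → ∀ n : ℕ,
      Integrable (fun x ↦ u (min x n)) ρ := fun hρ n ↦
    (hdom hρ).mono' (hmeas n).aestronglyMeasurable (ae_of_all _ (hbound n))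
  have hconv : ∀ {ρ : Measure ℝ} [IsProbabilityMeasure ρ], Integrable u ρ →
      Tendsto (fun n : ℕ ↦ ∫ x, u (min x n) ∂ρ) atTop (𝓝 (∫ x, u x ∂ρ)) := fun hρ ↦
    tendsto_integral_of_dominated_convergence _ (fun n ↦ (hmeas n).aestronglyMeasurable)
      (hdom hρ) (fun n ↦ ae_of_all _ (hbound n)) (ae_of_all _ hlim)
  exact le_of_tendsto_of_tendsto' (hconv hν) (hconv hμ) fun n ↦
    integral_comp_min_le h hu hm n (hint hμ n) (hint hν n)

/-- `X ≽ₛₛ𝒹 Y` iff for every `a ∈ ℝ`, `∫_{-∞}^a (P(Y ≤ s) - P(X ≤ s)) ds ≥ 0`. -/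
theorem ssd_iff_integral_cdf_diff_nonneg
    {Ω Ω' : Type*} [MeasurableSpace Ω] [MeasurableSpace Ω']
    (P : Measure Ω) [IsProbabilityMeasure P] (P' : Measure Ω') [IsProbabilityMeasure P']
    (X : Ω → ℝ) (Y : Ω' → ℝ) (hXm : Measurable X) (hYm : Measurable Y)
    (hX : Integrable X P) (hY : Integrable Y P') :
    SSD (Measure.map X P) (Measure.map Y P') ↔
      ∀ a : ℝ, 0 ≤ ∫ s in Set.Iic a,
        (cdf (Measure.map Y P') s - cdf (Measure.map X P) s) := by
  have := Measure.isProbabilityMeasure_map (μ := P) hXm.aemeasurable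
  have := Measure.isProbabilityMeasure_map (μ := P') hYm.aemeasurable
  have hμ : Integrable (fun x ↦ x) (Measure.map X P) :=
    (integrable_map_measure aestronglyMeasurable_id hXm.aemeasurable).2 hX
  have hν : Integrable (fun x ↦ x) (Measure.map Y P') :=
    (integrable_map_measure aestronglyMeasurable_id hYm.aemeasurable).2 hY
  simp_rw [integral_cdf_sub_nonneg_iff hμ hν]
  exact ⟨fun h ↦ h.lintegral_ofReal_sub_le hμ hν, ssd_of_lintegral_ofReal_sub_le⟩
end

section
/- Let X and Y be real-valued random variables with finite expectation. If X single-crossing dominates Y, then X second-order stochastically dominates Y. -/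
open MeasureTheory ProbabilityTheory
open scoped NNReal ENNReal

/-- Single-crossing dominance: `μ ≽ₛ𝒸 ν` iff the mean of `μ` is at least the mean of `ν`
and there is a crossing point `a` with `F_ν(s) ≥ F_μ(s) ↔ s ≤ a`. -/
def SCD (μ ν : Measure ℝ) : Prop :=
  (∫ x, x ∂ν) ≤ (∫ x, x ∂μ) ∧ ∃ a : ℝ, ∀ s : ℝ, cdf μ s ≤ cdf ν s ↔ s ≤ a

/-- To compare two measures on a nonempty lower set `L`, it suffices to compare them on
the half-lines `Iic s` contained in `L`, for `s` beyond some element of `L`. -/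
theorem measure_le_of_isLowerSet {μ ν : Measure ℝ} {L : Set ℝ} (hL : IsLowerSet L) {b : ℝ}
    (hb : b ∈ L)
    (h : ∀ s ∈ L, b ≤ s → μ (Set.Iic s) ≤ ν (Set.Iic s)) : μ L ≤ ν L := by
  obtain ⟨s, hsL, hbs, hmono, hU⟩ : ∃ s : ℕ → ℝ, (∀ n, s n ∈ L) ∧ (∀ n, b ≤ s n) ∧
      Monotone s ∧ L = ⋃ n, Set.Iic (s n) := by
    by_cases hbdd : BddAbove L
    · have hlub := isLUB_csSup ⟨b, hb⟩ hbdd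
      obtain ⟨s, hmono, -, hlim, hs⟩ := hlub.exists_seq_monotone_tendsto ⟨b, hb⟩
      by_cases hmem : sSup L ∈ L
      · refine ⟨fun _ => sSup L, fun _ => hmem, fun _ => hlub.1 hb, monotone_const, ?_⟩
        ext x
        simp only [Set.mem_iUnion, Set.mem_Iic, exists_const]
        exact ⟨fun hx => hlub.1 hx, fun hx => hL hx hmem⟩
      · have hmax : ∀ n, max b (s n) ∈ L := fun n => by
          rcases max_choice b (s n) with h' | h' <;> rw [h'] <;> simp [hb, hs]
        refine ⟨fun n => max b (s n), hmax, fun n => le_max_left _ _,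
          fun m n hmn => max_le_max le_rfl (hmono hmn), ?_⟩
        ext x
        simp only [Set.mem_iUnion, Set.mem_Iic]
        refine ⟨fun hx => ?_, fun ⟨n, hn⟩ => hL hn (hmax n)⟩
        have hlt : x < sSup L :=
          lt_of_le_of_ne (hlub.1 hx) (fun h' => hmem (h' ▸ hx))
        obtain ⟨n, hn⟩ := (hlim.eventually (lt_mem_nhds hlt)).exists
        exact ⟨n, hn.le.trans (le_max_right _ _)⟩
    · have huniv : ∀ x, x ∈ L := fun x => by
        obtain ⟨y, hy, hxy⟩ := not_bddAbove_iff.1 hbdd x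
        exact hL hxy.le hy
      refine ⟨fun n => b + n, fun n => huniv _, fun n => by simp, fun m n hmn => by
        simpa using hmn, ?_⟩
      ext x
      simp only [Set.mem_iUnion, Set.mem_Iic, huniv, true_iff]
      obtain ⟨n, hn⟩ := exists_nat_ge (x - b)
      exact ⟨n, by linarith⟩
  have hIic : Monotone fun n => Set.Iic (s n) := fun m n hmn => Set.Iic_subset_Iic.2 (hmono hmn)
  rw [hU, hIic.measure_iUnion, hIic.measure_iUnion]
  exact iSup_mono fun n => h _ (hsL n) (hbs n)

/-- A concave function on `ℝ` has a supergradient at every point. -/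
theorem ConcaveOn.exists_supergradient {u : ℝ → ℝ} (hu : ConcaveOn ℝ Set.univ u) (a : ℝ) :
    ∃ c : ℝ, ∀ x, u x ≤ u a + c * (x - a) := by
  obtain ⟨c, hc₁, hc₂⟩ := exists_between_of_forall_le
    (s := (fun z => (u z - u a) / (z - a)) '' Set.Ioi a)
    (t := (fun x => (u a - u x) / (a - x)) '' Set.Iio a)
    (Set.nonempty_Ioi.image _) (Set.nonempty_Iio.image _) (by
      rintro _ ⟨z, hz, rfl⟩ _ ⟨x, hx, rfl⟩
      exact hu.slope_anti_adjacent trivial trivial hx hz)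
  refine ⟨c, fun x => ?_⟩
  rcases lt_trichotomy x a with hx | rfl | hx
  · have := hc₂ ⟨x, hx, rfl⟩
    rw [le_div_iff₀ (sub_pos.2 hx)] at this
    linarith
  · simp
  · have := hc₁ ⟨x, hx, rfl⟩
    rw [div_le_iff₀ (sub_pos.2 hx)] at this
    linarith

/-- If `ν` has more mass than `μ` on the half-lines `Iic s` with `s ≤ a` and less on those with
`a ≤ s`, then `ν` gives a larger integral to convex functions that attain their minimum `0`
at `a`. -/
theorem ConvexOn.integral_le_integral_of_measure_Iic {μ ν : Measure ℝ} [IsProbabilityMeasure μ]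
    [IsProbabilityMeasure ν] {a : ℝ} (hlo : ∀ s ≤ a, μ (Set.Iic s) ≤ ν (Set.Iic s))
    (hhi : ∀ s, a ≤ s → ν (Set.Iic s) ≤ μ (Set.Iic s)) {f : ℝ → ℝ}
    (hf : ConvexOn ℝ Set.univ f) (hf₀ : ∀ x, 0 ≤ f x) (hfa : f a = 0)
    (hμ : Integrable f μ) (hν : Integrable f ν) : ∫ x, f x ∂μ ≤ ∫ x, f x ∂ν := by
  have hnn : ∀ ρ : Measure ℝ, 0 ≤ᵐ[ρ] f := fun ρ => Filter.Eventually.of_forall hf₀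
  rw [← ENNReal.ofReal_le_ofReal_iff (integral_nonneg hf₀),
    ofReal_integral_eq_lintegral_ofReal hμ (hnn μ), ofReal_integral_eq_lintegral_ofReal hν (hnn ν),
    lintegral_eq_lintegral_meas_lt μ (hnn μ) hμ.aemeasurable,
    lintegral_eq_lintegral_meas_lt ν (hnn ν) hν.aemeasurable]
  refine setLIntegral_mono' measurableSet_Ioi fun t (ht : 0 < t) => ?_
  have hconv : ∀ {x y z : ℝ}, x ≤ y → y ≤ z → f x ≤ t → f z ≤ t → f y ≤ t :=
    fun hxy hyz hx hz =>
      (hf.le_max_of_mem_Icc trivial trivial ⟨hxy, hyz⟩).trans (max_le hx hz)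
  set A : Set ℝ := {x | x < a ∧ t < f x} with hA
  set K : Set ℝ := {x | x ≤ a ∨ f x ≤ t} with hK
  have hAlow : IsLowerSet A := fun x y hyx ⟨hxa, hx⟩ =>
    ⟨hyx.trans_lt hxa, lt_of_not_ge fun hy =>
      hx.not_ge (hconv hyx hxa.le hy (hfa.trans_le ht.le))⟩
  have hKlow : IsLowerSet K := by
    intro x y hyx hx
    rcases le_total y a with hya | hay
    · exact Or.inl hya
    · rcases hx with hx | hx
      · exact Or.inl (hyx.trans hx)
      · exact Or.inr (hconv hay hyx (hfa.trans_le ht.le) hx)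
  have hKm : MeasurableSet K := hKlow.ordConnected.measurableSet
  have hset : {x | t < f x} = A ∪ Kᶜ := by
    ext x
    simp only [hA, hK, Set.mem_ofPred_eq, Set.mem_union, Set.mem_compl_iff, not_or, not_le]
    refine ⟨fun hx => ?_, fun hx => hx.elim And.right And.right⟩
    rcases lt_trichotomy x a with h | rfl | h
    · exact Or.inl ⟨h, hx⟩
    · exact absurd hx (by linarith)
    · exact Or.inr ⟨h, hx⟩
  have hdisj : Disjoint A Kᶜ :=
    Set.disjoint_left.2 fun x hx hxK => hxK (Or.inl hx.1.le)
  rw [hset, measure_union hdisj hKm.compl, measure_union hdisj hKm.compl,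
    prob_compl_eq_one_sub hKm, prob_compl_eq_one_sub hKm]
  refine add_le_add ?_ (tsub_le_tsub_left ?_ _)
  · rcases A.eq_empty_or_nonempty with h | ⟨b, hb⟩
    · simp [h]
    · exact measure_le_of_isLowerSet hAlow hb fun s hs _ => hlo s hs.1.le
  · exact measure_le_of_isLowerSet hKlow (Or.inl le_rfl : a ∈ K) fun s _ hs => hhi s hs

/-- **Single-crossing dominance implies second-order stochastic dominance.** -/
theorem ssd_of_scd
    {Ω Ω' : Type*} [MeasurableSpace Ω] [MeasurableSpace Ω']
    (P : Measure Ω) [IsProbabilityMeasure P] (P' : Measure Ω') [IsProbabilityMeasure P']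
    (X : Ω → ℝ) (Y : Ω' → ℝ) (hXm : Measurable X) (hYm : Measurable Y)
    (hX : Integrable X P) (hY : Integrable Y P')
    (h : SCD (Measure.map X P) (Measure.map Y P')) :
    SSD (Measure.map X P) (Measure.map Y P') := by
  have := Measure.isProbabilityMeasure_map (μ := P) hXm.aemeasurable
  have := Measure.isProbabilityMeasure_map (μ := P') hYm.aemeasurable
  have hXi : Integrable (fun x : ℝ => x) (Measure.map X P) :=
    (integrable_map_measure aestronglyMeasurable_id hXm.aemeasurable).2 hX
  have hYi : Integrable (fun x : ℝ => x) (Measure.map Y P') :=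
    (integrable_map_measure aestronglyMeasurable_id hYm.aemeasurable).2 hY
  generalize Measure.map X P = μ at *
  generalize Measure.map Y P' = ν at *
  obtain ⟨hmean, a, ha⟩ := h
  intro u hu humono huμ huν
  have hlo : ∀ s ≤ a, μ (Set.Iic s) ≤ ν (Set.Iic s) := fun s hs => by
    rw [← ofReal_cdf μ, ← ofReal_cdf ν]
    exact ENNReal.ofReal_le_ofReal ((ha s).2 hs)
  have hgt : ∀ s, a < s → cdf ν s ≤ cdf μ s := fun s hs =>
    (not_le.1 fun h => hs.not_ge ((ha s).1 h)).le
  have hge : cdf ν a ≤ cdf μ a :=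
    le_of_tendsto_of_tendsto
      (((cdf ν).right_continuous a).mono Set.Ioi_subset_Ici_self)
      (((cdf μ).right_continuous a).mono Set.Ioi_subset_Ici_self)
      (Filter.eventually_of_mem self_mem_nhdsWithin hgt)
  have hhi : ∀ s, a ≤ s → ν (Set.Iic s) ≤ μ (Set.Iic s) := fun s hs => by
    rw [← ofReal_cdf μ, ← ofReal_cdf ν]
    refine ENNReal.ofReal_le_ofReal ?_
    rcases hs.eq_or_lt with rfl | hs
    · exact hge
    · exact hgt s hs
  obtain ⟨c, hc⟩ := hu.exists_supergradient a
  have hc₀ : 0 ≤ c := by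
    have h₁ := hc (a + 1)
    have h₂ := humono (by linarith : a ≤ a + 1)
    linarith
  set f : ℝ → ℝ := fun x => (c * x + (u a - c * a)) - u x with hf
  have hlin : ConvexOn ℝ Set.univ fun x : ℝ => c * x + (u a - c * a) :=
    ((convexOn_id convex_univ).smul hc₀).add_const _
  have haff : ∀ {ρ : Measure ℝ} [IsProbabilityMeasure ρ], Integrable (fun x : ℝ => x) ρ →
      Integrable (fun x : ℝ => c * x + (u a - c * a)) ρ :=
    fun hρ => (hρ.const_mul c).add (integrable_const _)
  have hint : ∀ {ρ : Measure ℝ} [IsProbabilityMeasure ρ], Integrable (fun x : ℝ => x) ρ →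
      Integrable u ρ → ∫ x, f x ∂ρ = c * ∫ x, x ∂ρ + (u a - c * a) - ∫ x, u x ∂ρ := by
    intro ρ _ hρ hρu
    rw [hf, integral_sub (haff hρ) hρu, integral_add (hρ.const_mul c) (integrable_const _),
      integral_const_mul]
    simp
  have key := ConvexOn.integral_le_integral_of_measure_Iic hlo hhi (f := f) (hlin.sub hu)
    (fun x => by have := hc x; simp only [hf]; linarith) (by simp [hf])
    ((haff hXi).sub huμ) ((haff hYi).sub huν)
  rw [hint hXi huμ, hint hYi huν] at key
  linarith [mul_le_mul_of_nonneg_left hmean hc₀]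
end

section
/- Let α > 1 and β > 1 with (α − 1)(β − 1) ≥ 1/9, and define h : (0,1) → ℝ by h(x) = (α−1)/x² + (β−1)/(1−x)² − (α+β). Then h(x) ≥ 0 for all x ∈ (0,1). -/
/-- Region `R2`: for `α, β > 1` with `(α-1)(β-1) ≥ 1/9`, the difference
`h(x) = (α-1)/x² + (β-1)/(1-x)² - (α+β)` between the second derivatives of the Normal
and Beta log-densities is nonnegative on `(0,1)`. -/
theorem region_R2_h_nonneg
    (α β : ℝ) (hα : 1 < α) (hβ : 1 < β) (hprod : 1/9 ≤ (α - 1) * (β - 1)) :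
    ∀ x ∈ Set.Ioo (0:ℝ) 1,
      0 ≤ (α - 1) / x ^ 2 + (β - 1) / (1 - x) ^ 2 - (α + β) := by
  rintro x ⟨hx0, hx1⟩
  have ha : 0 < α - 1 := sub_pos.2 hα
  have hb : 0 < β - 1 := sub_pos.2 hβ
  have hy : 0 < 1 - x := sub_pos.2 hx1
  have hxy : 0 < x * (1 - x) := mul_pos hx0 hy
  have hne : x ≠ 0 := hx0.ne'
  have hne' : 1 - x ≠ 0 := hy.ne'
  set u := (α - 1) * ((1 - x) * (1 + x) / x ^ 2) with hu
  set v := (β - 1) * (x * (2 - x) / (1 - x) ^ 2) with hv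
  have hu0 : 0 < u := by positivity
  have hv0 : 0 < v := by
    have : 0 < 2 - x := by linarith
    positivity
  have huv : u * v = (α - 1) * (β - 1) * ((2 + x * (1 - x)) / (x * (1 - x))) := by
    rw [hu, hv]
    field_simp
    ring
  have hratio : 9 ≤ (2 + x * (1 - x)) / (x * (1 - x)) := by
    rw [le_div_iff₀ hxy]
    nlinarith [sq_nonneg (2 * x - 1)]
  have huv1 : 1 ≤ u * v := by
    rw [huv]
    nlinarith
  have hsum : (α - 1) / x ^ 2 + (β - 1) / (1 - x) ^ 2 - (α + β) = u + v - 2 := by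
    rw [hu, hv]
    field_simp
    ring
  rw [hsum]
  nlinarith [sq_nonneg (u - v)]
end

section
/- Define f₁(A, B) = log(1 + A) + A·log(√(A/(A + B + 2))) + B·log(1 − √(A/(A + B + 2))) + (1/2)·log(2π) − (1/2)·log(A + B + 2). Then f₁(A, B) > 0 for all A ≥ 1/3 and all B with 0 < B ≤ 1/(9A). -/
open Real

/-- The tangent line of `log` at `c` lies above the graph. -/
theorem log_le_tangent {x c : ℝ} (hx : 0 < x) (hc : 0 < c) :
    Real.log x ≤ Real.log c + x / c - 1 := by
  have h := Real.log_le_sub_one_of_pos (div_pos hx hc)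
  rw [Real.log_div hx.ne' hc.ne'] at h
  linarith

theorem log_two_pi_gt : (1.8367 : ℝ) < Real.log (2 * π) := by
  have h : Real.log ((2 : ℝ) ^ 53) < Real.log ((2 * π) ^ 20) := by
    apply Real.log_lt_log (by positivity)
    calc (2 : ℝ) ^ 53 < (2 * 3.14) ^ 20 := by norm_num
      _ ≤ (2 * π) ^ 20 := by gcongr; exact Real.pi_gt_d2.le
  rw [Real.log_pow, Real.log_pow] at h
  push_cast at h
  linarith [Real.log_two_gt_d9]

theorem log_three_halves_lt : Real.log (3 / 2) < 0.416 := by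
  have h : Real.log ((3 : ℝ) ^ 5) < Real.log ((2 : ℝ) ^ 8) :=
    Real.log_lt_log (by norm_num) (by norm_num)
  rw [Real.log_pow, Real.log_pow] at h
  push_cast at h
  rw [Real.log_div (by norm_num) (by norm_num)]
  linarith [Real.log_two_lt_d9]

theorem log_four : Real.log 4 = 2 * Real.log 2 := by
  rw [show (4 : ℝ) = 2 ^ 2 by norm_num, Real.log_pow]
  norm_num

/-- The gap function
`f₁(A,B) = log(1+A) + A log(√(A/(A+B+2))) + B log(1 - √(A/(A+B+2)))
  + (1/2) log(2π) - (1/2) log(A+B+2)`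
is strictly positive for `A ≥ 1/3` and `0 < B ≤ 1/(9A)`. -/
theorem f1_pos
    (A B : ℝ) (hA : 1/3 ≤ A) (hB0 : 0 < B) (hB : B ≤ 1 / (9 * A)) :
    0 < Real.log (1 + A) + A * Real.log (Real.sqrt (A / (A + B + 2)))
      + B * Real.log (1 - Real.sqrt (A / (A + B + 2)))
      + (1/2) * Real.log (2 * π) - (1/2) * Real.log (A + B + 2) := by
  have hA0 : 0 < A := by linarith
  have hN : 0 < A + B + 2 := by linarith
  have hAB : 9 * (A * B) ≤ 1 := by
    rw [le_div_iff₀ (by positivity)] at hB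
    linarith
  have hsq : Real.sqrt (A / (A + B + 2)) ^ 2 * (A + B + 2) = A := by
    rw [Real.sq_sqrt (by positivity), div_mul_cancel₀ _ hN.ne']
  have hs0 := Real.sqrt_nonneg (A / (A + B + 2))
  rw [Real.log_sqrt (by positivity)]
  have hinv : Real.log (A / (A + B + 2)) = -Real.log ((A + B + 2) / A) := by
    rw [← Real.log_inv, inv_div]
  rw [hinv]
  set s := Real.sqrt (A / (A + B + 2))
  have hratio : Real.log ((A + B + 2) / (1 + A) ^ 2)
      = Real.log (A + B + 2) - 2 * Real.log (1 + A) := by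
    rw [Real.log_div hN.ne' (by positivity), Real.log_pow]
    norm_num
  have hpi := log_two_pi_gt
  have hL1 := Real.log_two_gt_d9
  have hL2 := Real.log_two_lt_d9
  have hq : 0 < (A + B + 2) / (1 + A) ^ 2 := by positivity
  have htangent_four : A * Real.log ((A + B + 2) / A)
      ≤ A * (2 * Real.log 2 - 1) + (A + B + 2) / 4 := by
    have h := mul_le_mul_of_nonneg_left
      (log_le_tangent (x := (A + B + 2) / A) (c := 4) (by positivity) (by norm_num)) hA0.le
    rw [log_four] at h
    calc _ ≤ _ := h
      _ = _ := by field_simp; ring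
  have hAL : A * Real.log 2 ≤ A * 0.6932 := by gcongr; linarith
  have hBL : B * Real.log 2 ≤ B * 0.6932 := by gcongr; linarith
  rcases le_total A (2 / 3) with h1 | h1
  · have hs : s ≤ 1 / 2 := by
      by_contra! h
      nlinarith [mul_pos (sub_pos.2 h) (by linarith : 0 < s + 1 / 2)]
    have hlog : -Real.log 2 ≤ Real.log (1 - s) := by
      rw [← Real.log_inv]
      exact Real.log_le_log (by norm_num) (by linarith)
    have hBlog := mul_le_mul_of_nonneg_left hlog hB0.le
    have hq' := log_le_tangent hq (c := 3 / 2) (by norm_num)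
    have h32 := log_three_halves_lt
    have hchord : B ≤ 1 / 2 - A / 2 := by
      by_contra! h
      nlinarith [mul_nonneg (sub_nonneg.2 hA) (sub_nonneg.2 h1), mul_pos (sub_pos.2 h) hA0]
    have hqb : (A + B + 2) / (1 + A) ^ 2 ≤ 1.5 - 1.2 * (A - 1 / 3) := by
      rw [div_le_iff₀ (by positivity)]
      nlinarith [mul_nonneg (sub_nonneg.2 hA) (sub_nonneg.2 h1),
        mul_nonneg (mul_nonneg (sub_nonneg.2 hA) (sub_nonneg.2 h1)) hA0.le]
    linarith
  rcases le_total A 2 with h2 | h2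
  · have hs : s ≤ 3 / 4 := by
      by_contra! h
      nlinarith [mul_pos (sub_pos.2 h) (by linarith : 0 < s + 3 / 4)]
    have hlog : -(2 * Real.log 2) ≤ Real.log (1 - s) := by
      rw [← log_four, ← Real.log_inv]
      exact Real.log_le_log (by norm_num) (by linarith)
    have hBlog := mul_le_mul_of_nonneg_left hlog hB0.le
    have hq' := Real.log_le_sub_one_of_pos hq
    have hchord : B ≤ 2 / 9 - A / 12 := by
      by_contra! h
      nlinarith [mul_nonneg (sub_nonneg.2 h1) (sub_nonneg.2 h2), mul_pos (sub_pos.2 h) hA0]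
    have hqb : (A + B + 2) / (1 + A) ^ 2 ≤ 1.1 - 0.4 * (A - 2 / 3) := by
      rw [div_le_iff₀ (by positivity)]
      nlinarith [mul_nonneg (sub_nonneg.2 h1) (sub_nonneg.2 h2),
        mul_nonneg (mul_nonneg (sub_nonneg.2 h1) (sub_nonneg.2 h2)) hA0.le]
    linarith
  · have hB18 : B ≤ 1 / 18 := by nlinarith
    have hs : s < 1 := by
      by_contra! h
      linarith [mul_nonneg (sub_nonneg.2 (one_le_pow₀ h (n := 2))) hN.le]
    have hlog : -Real.log (A + B + 2) ≤ Real.log (1 - s) := by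
      rw [← Real.log_inv]
      refine Real.log_le_log (by positivity) ?_
      rw [inv_le_iff_one_le_mul₀ hN]
      nlinarith [mul_nonneg hN.le (sq_nonneg (1 - s))]
    have hBlog := mul_le_mul_of_nonneg_left hlog hB0.le
    have hlogN := mul_le_mul_of_nonneg_left
      (log_le_tangent hN (c := 4) (by norm_num)) hB0.le
    rw [log_four] at hlogN
    have hq' := Real.log_le_sub_one_of_pos hq
    have hqb : (A + B + 2) / (1 + A) ^ 2 ≤ 0.46 := by
      rw [div_le_iff₀ (by positivity)]
      nlinarith
    have hAlog : A * Real.log ((A + B + 2) / A) ≤ B + 2 := by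
      have h := mul_le_mul_of_nonneg_left
        (Real.log_le_sub_one_of_pos (x := (A + B + 2) / A) (by positivity)) hA0.le
      calc _ ≤ _ := h
        _ = _ := by field_simp; ring
    have hBN : B * (2 * Real.log 2 + (A + B + 2) / 4 - 1) ≤ 0.08 := by
      linarith [mul_nonneg hB0.le (sub_nonneg.2 hB18)]
    linarith
end

section
/- Define f₂(A, B) = log(1 + A) + A·log(1 − √(B/(A + B + 2))) + B·log(√(B/(A + B + 2))) + (1/2)·log(2π) − (1/2)·log(A + B + 2). Then f₂(A, B) > 0 for all A ≥ 1/3 and all B with 0 < B ≤ 1/(9A). -/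
open Real

/-- If `r` bounds `b / (c s)`, then `b log s ≥ b (1 - log c) - r`. -/
theorem mul_log_ge_of_le_mul {b c s r : ℝ} (hb : 0 ≤ b) (hc : 0 < c) (hs : 0 < s)
    (h : b ≤ r * (c * s)) : b * (1 - Real.log c) - r ≤ b * Real.log s := by
  have hcs : 0 < c * s := mul_pos hc hs
  have h1 := Real.one_sub_inv_le_log_of_pos hcs
  rw [Real.log_mul hc.ne' hs.ne'] at h1
  have h2 : b * (c * s)⁻¹ ≤ r := by
    rw [← div_eq_mul_inv]
    exact (div_le_iff₀ hcs).2 h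
  nlinarith [mul_le_mul_of_nonneg_left h1 hb]

/-- The logarithmic bound `-(31/20) s ≤ log (1 - s)` on `[0, √(1/8)]`. -/
theorem neg_mul_le_log_one_sub {s : ℝ} (hs : 0 ≤ s) (hs8 : s ^ 2 ≤ 1 / 8) :
    -(31 / 20 * s) ≤ Real.log (1 - s) := by
  have hs1 : s ≤ 11 / 31 := by nlinarith
  have hpos : 0 < 1 - s := by linarith
  refine le_trans ?_ (Real.one_sub_inv_le_log_of_pos hpos)
  have h : (1 - s)⁻¹ ≤ 1 + 31 / 20 * s := by
    rw [inv_le_iff_one_le_mul₀ hpos]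
    nlinarith
  linarith

/-- The elementary rational inequality to which positivity of the gap reduces. -/
theorem rational_gap_pos {A : ℝ} (hA : 1 / 3 ≤ A) :
    0 < (1 - (A + 7 / 3) / (1 + A) ^ 2) / 2 + 1 / 2
      - 31 / 20 * ((A / (A + 2) + 1 / 4) / 3) := by
  obtain ⟨x, hx, rfl⟩ : ∃ x : ℝ, 0 ≤ x ∧ A = x + 1 / 3 := ⟨A - 1 / 3, by linarith, by ring⟩
  have key : (1 - (x + 1 / 3 + 7 / 3) / (1 + (x + 1 / 3)) ^ 2) / 2 + 1 / 2
      - 31 / 20 * (((x + 1 / 3) / (x + 1 / 3 + 2) + 1 / 4) / 3) =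
      (17 / 48 * x ^ 3 + 553 / 240 * x ^ 2 + 139 / 45 * x + 79 / 405) /
        ((1 + (x + 1 / 3)) ^ 2 * (x + 1 / 3 + 2)) := by
    field_simp
    ring
  rw [key]
  positivity

/-- The gap function
`f₂(A,B) = log(1+A) + A log(1 - √(B/(A+B+2))) + B log(√(B/(A+B+2)))
  + (1/2) log(2π) - (1/2) log(A+B+2)`
is strictly positive for `A ≥ 1/3` and `0 < B ≤ 1/(9A)`. -/
theorem f2_pos
    (A B : ℝ) (hA : 1/3 ≤ A) (hB0 : 0 < B) (hB : B ≤ 1 / (9 * A)) :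
    0 < Real.log (1 + A) + A * Real.log (1 - Real.sqrt (B / (A + B + 2)))
      + B * Real.log (Real.sqrt (B / (A + B + 2)))
      + (1/2) * Real.log (2 * π) - (1/2) * Real.log (A + B + 2) := by
  have hA0 : 0 < A := by linarith
  have hAB : A * B ≤ 1 / 9 := by
    rw [le_div_iff₀ (by positivity)] at hB
    linarith
  have hB3 : B ≤ 1 / 3 := by nlinarith
  have hD : 0 < A + B + 2 := by positivity
  have hs0 : 0 < √(B / (A + B + 2)) := Real.sqrt_pos.2 (by positivity)
  have hs2 : √(B / (A + B + 2)) ^ 2 = B / (A + B + 2) := Real.sq_sqrt (by positivity)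
  generalize √(B / (A + B + 2)) = s at hs0 hs2 ⊢
  have hs8 : s ^ 2 ≤ 1 / 8 := by
    rw [hs2, div_le_iff₀ hD]
    linarith
  have hAs : A * s ≤ (A / (A + 2) + 1 / 4) / 3 := by
    have hw : 0 < A / (A + 2) := by positivity
    have hsq : (A * s) ^ 2 ≤ A / (A + 2) / 9 := by
      rw [mul_pow, hs2, div_div, ← mul_div_assoc, div_le_div_iff₀ hD (by positivity)]
      have : A * B * (A * (A + 2)) ≤ 1 / 9 * (A * (A + 2)) := by gcongr
      nlinarith [mul_pos hA0 hB0]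
    refine (sq_le_sq₀ (by positivity) (by positivity)).1 (hsq.trans ?_)
    nlinarith [sq_nonneg (A / (A + 2) - 1 / 4)]
  have hlogA : -(31 / 20 * ((A / (A + 2) + 1 / 4) / 3)) ≤ A * Real.log (1 - s) := by
    nlinarith [mul_le_mul_of_nonneg_left (neg_mul_le_log_one_sub hs0.le hs8) hA0.le]
  have hlogB : -(1 / 2 * Real.log 2) ≤ B * Real.log s := by
    have hle : B ≤ 1 / 3 * (√8 * s) := by
      refine (sq_le_sq₀ (by positivity) (by positivity)).1 ?_
      rw [mul_pow, mul_pow, hs2, Real.sq_sqrt (by norm_num), ← mul_div_assoc, ← mul_div_assoc,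
        le_div_iff₀ hD]
      have : B * (A + B + 2) ≤ 8 / 9 := by nlinarith
      nlinarith [mul_le_mul_of_nonneg_left this hB0.le]
    have h := mul_log_ge_of_le_mul hB0.le (by positivity) hs0 hle
    have h8 : Real.log √8 = 3 / 2 * Real.log 2 := by
      rw [Real.log_sqrt (by norm_num), show (8 : ℝ) = 2 ^ 3 by norm_num, Real.log_pow]
      push_cast
      ring
    rw [h8] at h
    nlinarith [Real.log_two_gt_d9]
  have hlogD : (1 - (A + 7 / 3) / (1 + A) ^ 2) / 2
      ≤ Real.log (1 + A) - 1 / 2 * Real.log (A + B + 2) := by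
    have hmono : Real.log (A + B + 2) ≤ Real.log (A + 7 / 3) :=
      Real.log_le_log hD (by linarith)
    have h := Real.one_sub_inv_le_log_of_pos (show 0 < (1 + A) ^ 2 / (A + 7 / 3) by positivity)
    rw [Real.log_div (by positivity) (by positivity), Real.log_pow, inv_div] at h
    push_cast at h
    linarith
  have hpi : 1 < Real.log π := by
    rw [Real.lt_log_iff_exp_lt Real.pi_pos]
    exact Real.exp_one_lt_three.trans Real.pi_gt_three
  rw [Real.log_mul two_ne_zero Real.pi_ne_zero]
  linarith [rational_gap_pos hA]
end

section
/- For all real A ≥ 1/3, the quantity log(1 + A) + (A/2)·log(A) − ((1 + A)/2)·log(A + 3) − 1/(9√A) + (1/2)·log(2π) is strictly positive. -/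
open Real

theorem log_one_add_le_pade {u : ℝ} (hu : 0 ≤ u) :
    Real.log (1 + u) ≤ u * (6 + u) / (6 + 4 * u) := by
  have hd : ∀ x : ℝ, 0 ≤ x → HasDerivAt
      (fun x => x * (6 + x) / (6 + 4 * x) - Real.log (1 + x))
      (((1 * (6 + x) + x * 1) * (6 + 4 * x) - x * (6 + x) * (4 * 1)) / (6 + 4 * x) ^ 2
        - 1 / (1 + x)) x := by
    intro x hx
    exact (((hasDerivAt_id' x).mul ((hasDerivAt_id' x).const_add 6)).div
      (((hasDerivAt_id' x).const_mul 4).const_add 6) (by positivity)).sub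
      (((hasDerivAt_id' x).const_add 1).log (by positivity))
  have hmono : MonotoneOn (fun x : ℝ => x * (6 + x) / (6 + 4 * x) - Real.log (1 + x))
      (Set.Ici 0) := by
    refine monotoneOn_of_deriv_nonneg (convex_Ici 0)
      (fun x hx => (hd x hx).continuousAt.continuousWithinAt)
      (fun x hx => (hd x (interior_subset hx)).differentiableAt.differentiableWithinAt) ?_
    intro x hx
    have hx0 : 0 ≤ x := interior_subset hx
    rw [(hd x hx0).deriv, sub_nonneg, div_le_div_iff₀ (by positivity) (by positivity)]
    nlinarith [pow_nonneg hx0 3]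
  have h := hmono Set.self_mem_Ici hu hu
  simp only [zero_mul, zero_div, add_zero, Real.log_one, sub_zero] at h
  linarith

theorem half_log_sub_log_lt {x : ℝ} (hx : 1 / 3 ≤ x) :
    (Real.log (x + 3) - Real.log x) / 2 <
      1 / (1 + x) + 1 / (x + 3) + 1 / (18 * x * Real.sqrt x) := by
  have hx0 : 0 < x := by linarith
  have hs : 0 < Real.sqrt x := Real.sqrt_pos.2 hx0
  rcases le_total x 1 with h1 | h1
  · have hlog : Real.log (x + 3) - Real.log x
        = 2 * Real.log 2 + Real.log (1 + (3 - 3 * x) / (4 * x)) := by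
      have h4 : 1 + (3 - 3 * x) / (4 * x) = (x + 3) / (2 ^ 2 * x) := by
        field_simp
        ring
      rw [h4, Real.log_div (by positivity) (by positivity),
        Real.log_mul (by positivity) (by positivity), Real.log_pow]
      push_cast
      ring
    have hp := log_one_add_le_pade (u := (3 - 3 * x) / (4 * x))
      (div_nonneg (by linarith) (by positivity))
    have hpade : (3 - 3 * x) / (4 * x) * (6 + (3 - 3 * x) / (4 * x)) /
        (6 + 4 * ((3 - 3 * x) / (4 * x))) = (1 - x) * (7 * x + 1) * 3 / (16 * x * (x + 1)) := by
      have h6 : 6 + 4 * ((3 - 3 * x) / (4 * x)) = 3 * (x + 1) / x := by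
        field_simp
        ring
      rw [h6]
      field_simp
      ring
    have hsqrt : 1 / (18 * x) ≤ 1 / (18 * x * Real.sqrt x) :=
      one_div_le_one_div_of_le (by positivity)
        (mul_le_of_le_one_right (by positivity) (Real.sqrt_le_one.2 h1))
    have hrat : 0.6932 + (1 - x) * (7 * x + 1) * 3 / (16 * x * (x + 1)) / 2 <
        1 / (1 + x) + 1 / (x + 3) + 1 / (18 * x) := by
      rw [← sub_pos]
      have : 1 / (1 + x) + 1 / (x + 3) + 1 / (18 * x)
          - (0.6932 + (1 - x) * (7 * x + 1) * 3 / (16 * x * (x + 1)) / 2)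
          = (288 * x * (x + 3) + 288 * x * (x + 1) + 16 * (x + 1) * (x + 3)
            - 0.6932 * 288 * x * (x + 1) * (x + 3) - 27 * (1 - x) * (7 * x + 1) * (x + 3))
            / (288 * x * (x + 1) * (x + 3)) := by
        field_simp
        ring
      rw [this]
      apply div_pos _ (by positivity)
      nlinarith [mul_nonneg (sub_nonneg.2 hx) (sub_nonneg.2 h1),
        mul_nonneg (mul_nonneg (sub_nonneg.2 hx) (sub_nonneg.2 h1)) hx0.le,
        sq_nonneg (x - 1 / 2)]
    have := Real.log_two_lt_d9
    rw [hpade] at hp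
    linarith
  · have hlog : Real.log (x + 3) - Real.log x = Real.log (1 + 3 / x) := by
      rw [← Real.log_div (by positivity) (by positivity)]
      congr 1
      field_simp
    have hp := log_one_add_le_pade (u := 3 / x) (by positivity)
    have hrat : 3 / x * (6 + 3 / x) / (6 + 4 * (3 / x)) / 2 ≤ 1 / (1 + x) + 1 / (x + 3) := by
      have h1' : 3 / x * (6 + 3 / x) / (6 + 4 * (3 / x)) / 2
          = 3 * (2 * x + 1) / (4 * x * (x + 2)) := by
        field_simp
        ring
      rw [h1', div_add_div _ _ (by positivity) (by positivity),
        div_le_div_iff₀ (by positivity) (by positivity)]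
      nlinarith [pow_le_pow_left₀ zero_le_one h1 2, pow_le_pow_left₀ zero_le_one h1 3]
    have : 0 < 1 / (18 * x * Real.sqrt x) := by positivity
    linarith

theorem g1_tilde_pos_one_third :
    0 < Real.log (1 + 1 / 3) + (1 / 3 / 2) * Real.log (1 / 3)
      - ((1 + 1 / 3) / 2) * Real.log (1 / 3 + 3)
      - 1 / (9 * Real.sqrt (1 / 3)) + (1/2) * Real.log (2 * π) := by
  have h43 : Real.log (1 + 1 / 3) = 2 * Real.log 2 - Real.log 3 := by
    rw [show (1 + 1 / 3 : ℝ) = 2 ^ 2 / 3 by norm_num, Real.log_div (by norm_num) (by norm_num),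
      Real.log_pow]
    norm_num
  have h13 : Real.log (1 / 3) = -Real.log 3 := by rw [one_div, Real.log_inv]
  have h103 : Real.log (1 / 3 + 3) = Real.log 2 + Real.log 5 - Real.log 3 := by
    rw [show (1 / 3 + 3 : ℝ) = 2 * 5 / 3 by norm_num, Real.log_div (by norm_num) (by norm_num),
      Real.log_mul (by norm_num) (by norm_num)]
  have hpi : Real.log (2 * π) = Real.log 2 + Real.log π :=
    Real.log_mul (by norm_num) Real.pi_ne_zero
  have h3pi : Real.log 3 ≤ Real.log π := Real.log_le_log (by norm_num) Real.pi_gt_three.le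
  have h5 : 3 * Real.log 5 ≤ 7 * Real.log 2 := by
    have h := Real.log_le_log (x := 5 ^ 3) (y := 2 ^ 7) (by norm_num) (by norm_num)
    rw [Real.log_pow, Real.log_pow] at h
    exact_mod_cast h
  have hsq : 1 / (9 * Real.sqrt (1 / 3)) < 1.7321 / 9 := by
    have h : 1 / 1.7321 < Real.sqrt (1 / 3) := Real.lt_sqrt_of_sq_lt (by norm_num)
    rw [div_lt_div_iff₀ (by positivity) (by norm_num)]
    linarith
  have := Real.log_two_gt_d9
  rw [h43, h13, h103, hpi]
  linarith

/-- The explicit lower bound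
`g̃₁(A) = log(1+A) + (A/2) log A - ((1+A)/2) log(A+3) - 1/(9√A) + (1/2) log(2π)`
is strictly positive for all `A ≥ 1/3`. -/
theorem g1_tilde_pos (A : ℝ) (hA : 1/3 ≤ A) :
    0 < Real.log (1 + A) + (A / 2) * Real.log A - ((1 + A) / 2) * Real.log (A + 3)
      - 1 / (9 * Real.sqrt A) + (1/2) * Real.log (2 * π) := by
  have hd : ∀ x : ℝ, 1 / 3 ≤ x → HasDerivAt
      (fun x => Real.log (1 + x) + (x / 2) * Real.log x - ((1 + x) / 2) * Real.log (x + 3)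
        - 1 / (9 * Real.sqrt x) + (1/2) * Real.log (2 * π))
      (1 / (1 + x) + 1 / (x + 3) + 1 / (18 * x * Real.sqrt x)
        - (Real.log (x + 3) - Real.log x) / 2) x := by
    intro x hx
    have hx0 : 0 < x := by linarith
    have hs : 0 < Real.sqrt x := Real.sqrt_pos.2 hx0
    have h := ((((((hasDerivAt_id' x).const_add 1).log (by positivity)).add
      (((hasDerivAt_id' x).div_const 2).mul (Real.hasDerivAt_log hx0.ne'))).sub
      ((((hasDerivAt_id' x).const_add 1).div_const 2).mul
        (((hasDerivAt_id' x).add_const 3).log (by positivity)))).sub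
      ((hasDerivAt_const x (1 : ℝ)).div ((Real.hasDerivAt_sqrt hx0.ne').const_mul 9)
        (by positivity))).add_const ((1/2) * Real.log (2 * π))
    refine h.congr_deriv ?_
    rw [mul_pow, Real.sq_sqrt hx0.le]
    field_simp
    ring
  have hmono : MonotoneOn
      (fun x => Real.log (1 + x) + (x / 2) * Real.log x - ((1 + x) / 2) * Real.log (x + 3)
        - 1 / (9 * Real.sqrt x) + (1/2) * Real.log (2 * π)) (Set.Ici (1 / 3)) := by
    refine monotoneOn_of_deriv_nonneg (convex_Ici _)
      (fun x hx => (hd x hx).continuousAt.continuousWithinAt)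
      (fun x hx => (hd x (interior_subset hx)).differentiableAt.differentiableWithinAt) ?_
    intro x hx
    rw [(hd x (interior_subset hx)).deriv]
    exact sub_nonneg.2 (half_log_sub_log_lt (interior_subset hx)).le
  exact g1_tilde_pos_one_third.trans_le (hmono Set.self_mem_Ici hA hA)
end
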